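/- Let the holomorphic completely overdetermined second order system (S_F) be involutive. Then the set of infinitesimal symmetries (θ, η) of (S_F) (with θ, η holomorphic on U) is a complex vector space of dimension at most (n+m+2)(n+m). -/

import Mathlib

open scoped BigOperators

noncomputable section

/-- The space of independent and dependent variables `(x, u) ∈ ℂⁿ × ℂᵐ`. -/
abbrev Wsp (n m : ℕ) := (Fin n → ℂ) × (Fin m → ℂ)

/-- The space of first-order jet variables `q = (q_i^k)`, with `q k i` standing for
`∂u^k/∂x_i`. -/
abbrev Jsp (n m : ℕ) := Fin m → Fin n → ℂ

/-- The first-order jet space `ℂⁿ × ℂᵐ × ℂ^{mn}` with coordinates `(x, u, q)`. -/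
abbrev Psp (n m : ℕ) := Wsp n m × Jsp n m

/-- Coordinate direction `∂/∂x_i` in the jet space. -/
def dirx (n m : ℕ) (i : Fin n) : Psp n m := (((Pi.single i 1 : Fin n → ℂ), 0), 0)

/-- Coordinate direction `∂/∂u^k` in the jet space. -/
def diru (n m : ℕ) (k : Fin m) : Psp n m := ((0, (Pi.single k 1 : Fin m → ℂ)), 0)

/-- Coordinate direction `∂/∂q_j^k` in the jet space. -/
def dirq (n m : ℕ) (k : Fin m) (j : Fin n) : Psp n m :=
  ((0, 0), (Pi.single k (Pi.single j 1) : Fin m → Fin n → ℂ))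

/-- The total derivative `D_i` applied to a function `ψ(x, u)` of the base
variables only: `D_i ψ = ∂ψ/∂x_i + Σ_k q_i^k ∂ψ/∂u^k`. -/
def Dtot {n m : ℕ} (ψ : Wsp n m → ℂ) (i : Fin n) (p : Psp n m) : ℂ :=
  fderiv ℂ ψ p.1 ((Pi.single i 1 : Fin n → ℂ), 0)
    + ∑ k, p.2 k i * fderiv ℂ ψ p.1 (0, (Pi.single k 1 : Fin m → ℂ))

/-- The total derivative `D_i^F` of the system `(S_F)` applied to a function
`φ(x, u, q)`: `D_i^F φ = ∂φ/∂x_i + Σ_k q_i^k ∂φ/∂u^k + Σ_{k,j} F_{ij}^k ∂φ/∂q_j^k`. -/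
def DtotF {n m : ℕ} (F : Fin n → Fin n → Fin m → Psp n m → ℂ)
    (φ : Psp n m → ℂ) (i : Fin n) (p : Psp n m) : ℂ :=
  fderiv ℂ φ p (dirx n m i) + ∑ k, p.2 k i * fderiv ℂ φ p (diru n m k)
    + ∑ k, ∑ j, F i j k p * fderiv ℂ φ p (dirq n m k j)

/-- The first prolongation coefficient `η_i^μ = D_i η^μ − Σ_j (D_i θ_j) q_j^μ`. -/
def eta1 {n m : ℕ} (θ : Fin n → Wsp n m → ℂ) (η : Fin m → Wsp n m → ℂ)
    (μ : Fin m) (i : Fin n) (p : Psp n m) : ℂ :=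
  Dtot (η μ) i p - ∑ j, Dtot (θ j) i p * p.2 μ j

/-- The second prolongation coefficient `η_{ij}^μ = D_j^F η_i^μ − Σ_k (D_j θ_k) F_{ik}^μ`. -/
def eta2 {n m : ℕ} (F : Fin n → Fin n → Fin m → Psp n m → ℂ)
    (θ : Fin n → Wsp n m → ℂ) (η : Fin m → Wsp n m → ℂ)
    (μ : Fin m) (i j : Fin n) (p : Psp n m) : ℂ :=
  DtotF F (eta1 θ η μ i) j p - ∑ k, Dtot (θ k) j p * F i k μ p

/-- The pair `(θ, η)` is an infinitesimal symmetry of the system `(S_F)` on `U × Q`: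
the determining identity
`η_{ij}^μ = Σ_s θ_s ∂F_{ij}^μ/∂x_s + Σ_k η^k ∂F_{ij}^μ/∂u^k + Σ_{k,l} η_l^k ∂F_{ij}^μ/∂q_l^k`
holds identically on `U × Q` for all `i, j, μ`. -/
def IsSymmetry {n m : ℕ} (U : Set (Wsp n m)) (Q : Set (Jsp n m))
    (F : Fin n → Fin n → Fin m → Psp n m → ℂ)
    (θ : Fin n → Wsp n m → ℂ) (η : Fin m → Wsp n m → ℂ) : Prop :=
  ∀ p ∈ U ×ˢ Q, ∀ (i j : Fin n) (μ : Fin m),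
    eta2 F θ η μ i j p =
      (∑ s, θ s p.1 * fderiv ℂ (F i j μ) p (dirx n m s))
      + (∑ k, η k p.1 * fderiv ℂ (F i j μ) p (diru n m k))
      + (∑ k, ∑ l, eta1 θ η k l p * fderiv ℂ (F i j μ) p (dirq n m k l))

/-- The vector field `Z_i = ∂/∂x_i + Σ_k q_i^k ∂/∂u^k + Σ_{k,j} F_{ij}^k ∂/∂q_j^k`
on the jet space. -/
def Zfield {n m : ℕ} (F : Fin n → Fin n → Fin m → Psp n m → ℂ) (i : Fin n)
    (p : Psp n m) : Psp n m :=
  dirx n m i + (∑ k, p.2 k i • diru n m k) + ∑ k, ∑ j, F i j k p • dirq n m k j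

/-- The system `(S_F)` is involutive: the fields `Z_i` pairwise commute on `U × Q`. -/
def IsInvolutive {n m : ℕ} (U : Set (Wsp n m)) (Q : Set (Jsp n m))
    (F : Fin n → Fin n → Fin m → Psp n m → ℂ) : Prop :=
  ∀ p ∈ U ×ˢ Q, ∀ i j : Fin n,
    fderiv ℂ (Zfield F j) p (Zfield F i p) = fderiv ℂ (Zfield F i) p (Zfield F j p)

/-- The set of all infinitesimal symmetries `(θ, η)` of `(S_F)`, with `θ, η`
holomorphic on `U`, inside the product module of component functions. -/
def SymSet {n m : ℕ} (U : Set (Wsp n m)) (Q : Set (Jsp n m))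
    (F : Fin n → Fin n → Fin m → Psp n m → ℂ) :
    Set ((Fin n → Wsp n m → ℂ) × (Fin m → Wsp n m → ℂ)) :=
  {X | (∀ j, DifferentiableOn ℂ (X.1 j) U) ∧ (∀ μ, DifferentiableOn ℂ (X.2 μ) U) ∧
    IsSymmetry U Q F X.1 X.2}


/-- The directional derivative of a holomorphic function of several variables is holomorphic. -/
theorem holo_fderiv_aux {E : Type*} [NormedAddCommGroup E] [NormedSpace ℂ E]
    [FiniteDimensional ℂ E] {U : Set E} (hU : IsOpen U) {f : E → ℂ}
    (hf : DifferentiableOn ℂ f U) (w₀ : E) (hw : w₀ ∈ U) (v₀ : E) :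
    DifferentiableAt ℂ (fun w => fderiv ℂ f w v₀) w₀ := by
  have : ProperSpace E := FiniteDimensional.proper ℂ E
  borelize E
  -- choose a ball on which f is bounded
  have hcont : ContinuousAt f w₀ := (hf.differentiableAt (hU.mem_nhds hw)).continuousAt
  obtain ⟨δ, hδ, hball⟩ : ∃ δ > 0, ∀ x ∈ Metric.ball w₀ (3 * δ), x ∈ U ∧ dist (f x) (f w₀) < 1 := by
    have h1 : ∀ᶠ x in nhds w₀, x ∈ U ∧ dist (f x) (f w₀) < 1 :=
      Filter.Eventually.and (hU.mem_nhds hw) (hcont.eventually (Metric.ball_mem_nhds _ one_pos))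
    obtain ⟨ε, hε, h⟩ := Metric.eventually_nhds_iff_ball.1 h1
    refine ⟨ε / 3, by positivity, fun x hx => h x ?_⟩
    convert hx using 2
    ring
  have hfd : ∀ x ∈ Metric.ball w₀ (2 * δ), ‖fderiv ℂ f x‖ ≤ 2 / δ := by
    intro x hx
    have hsub : ∀ y ∈ Metric.ball x δ, y ∈ Metric.ball w₀ (3 * δ) := by
      intro y hy
      rw [Metric.mem_ball] at *
      linarith [dist_triangle y x w₀]
    refine Complex.norm_fderiv_le_div_of_mapsTo_ball (R₁ := δ) (R₂ := 2) ?_ ?_ hδ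
    · exact hf.mono fun y hy => (hball y (hsub y hy)).1
    · intro y hy
      have h1 := (hball y (hsub y hy)).2
      have h2 := (hball x (hsub x (Metric.mem_ball_self hδ))).2
      rw [Metric.mem_closedBall]
      linarith [dist_triangle_right (f y) (f x) (f w₀)]
  -- rescale
  obtain ⟨r, hr, v, hv, hv0⟩ : ∃ r : ℂ, r ≠ 0 ∧ ∃ v : E, ‖v‖ < δ ∧ v₀ = r • v := by
    refine ⟨((‖v₀‖ + 1) / δ : ℝ), ?_, ((δ / (‖v₀‖ + 1) : ℝ) : ℂ) • v₀, ?_, ?_⟩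
    · exact_mod_cast (by positivity)
    · rw [norm_smul, Complex.norm_real, Real.norm_of_nonneg (by positivity), div_mul_eq_mul_div,
        div_lt_iff₀ (by positivity)]
      nlinarith [norm_nonneg v₀]
    · rw [smul_smul, ← Complex.ofReal_mul, div_mul_div_cancel₀ hδ.ne',
        div_self (by positivity)]
      simp
  subst hv0
  simp only [map_smul]
  refine DifferentiableAt.const_smul (c := r) ?_
  -- points w + z v
  have hin : ∀ w ∈ Metric.ball w₀ δ, ∀ z : ℂ, ‖z‖ ≤ 1 → w + z • v ∈ Metric.ball w₀ (2 * δ) := by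
    intro w hw z hz
    rw [mem_ball_iff_norm] at *
    calc ‖w + z • v - w₀‖ = ‖(w - w₀) + z • v‖ := by congr 1; abel
      _ ≤ ‖w - w₀‖ + ‖z • v‖ := norm_add_le _ _
      _ = ‖w - w₀‖ + ‖z‖ * ‖v‖ := by rw [norm_smul]
      _ < 2 * δ := by nlinarith [norm_nonneg v]
  have hinU : ∀ x ∈ Metric.ball w₀ (2 * δ), DifferentiableAt ℂ f x := by
    intro x hx
    refine hf.differentiableAt (hU.mem_nhds (hball x ?_).1)
    exact Metric.ball_subset_ball (by linarith) hx
  let G : E → ℝ → ℂ := fun w t => deriv (circleMap 0 1) t • (((circleMap 0 1 t - 0) ^ 2)⁻¹ •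
    f (w + circleMap 0 1 t • v))
  let G' : E → ℝ → (E →L[ℂ] ℂ) := fun w t => (deriv (circleMap 0 1) t *
    ((circleMap 0 1 t - 0) ^ 2)⁻¹) • fderiv ℂ f (w + circleMap 0 1 t • v)
  have hcm : ∀ t, ‖circleMap 0 1 t‖ ≤ 1 := by intro t; simp
  have hc0 : ∀ t, (circleMap 0 1 t : ℂ) ≠ 0 := by
    intro t h
    have : ‖circleMap 0 1 t‖ = 1 := by simp
    rw [h] at this
    simp at this
  have hGcont : ∀ w ∈ Metric.ball w₀ δ, Continuous (G w) := by
    intro w hw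
    have h1 : Continuous fun t => f (w + circleMap 0 1 t • v) := by
      rw [continuous_iff_continuousAt]
      intro t
      refine ContinuousAt.comp (f := fun t => w + circleMap 0 1 t • v)
        (hinU _ (hin w hw _ (hcm t))).continuousAt ?_
      exact (continuous_const.add ((continuous_circleMap 0 1).smul continuous_const)).continuousAt
    have h2 : Continuous fun t => deriv (circleMap 0 1) t := by
      simp only [deriv_circleMap]
      exact (continuous_circleMap 0 1).mul continuous_const
    have h3 : Continuous fun t => ((circleMap 0 1 t - 0) ^ 2)⁻¹ := by
      refine Continuous.inv₀ (by fun_prop) fun t => ?_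
      simp
    exact h2.smul (h3.smul h1)
  have hrep : ∀ w ∈ Metric.ball w₀ δ, fderiv ℂ f w v =
      (2 * Real.pi * Complex.I : ℂ)⁻¹ • ∫ t in (0 : ℝ)..2 * Real.pi, G w t := by
    intro w hw
    have hd : HasDerivAt (fun z : ℂ => f (w + z • v)) (fderiv ℂ f w v) 0 := by
      have h1 : HasDerivAt (fun z : ℂ => w + z • v) v 0 := by
        simpa using ((hasDerivAt_id (0 : ℂ)).smul_const v).const_add w
      have h2 : HasFDerivAt f (fderiv ℂ f w) (w + (0 : ℂ) • v) := by
        simpa using (hinU w (Metric.ball_subset_ball (by linarith) hw)).hasFDerivAt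
      exact h2.comp_hasDerivAt (0 : ℂ) h1
    have hO : IsOpen {z : ℂ | w + z • v ∈ Metric.ball w₀ (2 * δ)} :=
      Metric.isOpen_ball.preimage (by fun_prop)
    have := Complex.cderiv_eq_deriv (f := fun z : ℂ => f (w + z • v)) (z := 0) (r := 1) hO
      (fun z hz => DifferentiableAt.differentiableWithinAt
        (DifferentiableAt.comp (f := fun z : ℂ => w + z • v) z (hinU _ hz) (by fun_prop))) one_pos
      (fun z hz => hin w hw z (by simpa using hz))
    rw [hd.deriv] at this
    rw [← this]
    rfl
  have hmain : HasFDerivAt (fun w => ∫ t in (0 : ℝ)..2 * Real.pi, G w t)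
      (∫ t in (0 : ℝ)..2 * Real.pi, G' w₀ t) w₀ := by
    refine intervalIntegral.hasFDerivAt_integral_of_dominated_of_fderiv_le (bound := fun _ => 2 / δ)
      (Metric.ball_mem_nhds w₀ hδ) ?_ ?_ ?_ ?_ ?_ ?_
    · filter_upwards [Metric.ball_mem_nhds w₀ hδ] with w hw
      exact (hGcont w hw).aestronglyMeasurable
    · exact (hGcont w₀ (Metric.mem_ball_self hδ)).intervalIntegrable _ _
    · refine Measurable.aestronglyMeasurable ?_
      have h1 : Measurable fun t : ℝ => fderiv ℂ f (w₀ + circleMap 0 1 t • v) :=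
        (measurable_fderiv ℂ f).comp (f := fun t : ℝ => w₀ + circleMap 0 1 t • v)
          (Continuous.measurable (by fun_prop))
      have h2 : Measurable fun t => deriv (circleMap 0 1) t := by
        simp only [deriv_circleMap]
        exact ((continuous_circleMap 0 1).mul continuous_const).measurable
      have h3 : Measurable fun t => ((circleMap 0 1 t - 0) ^ 2)⁻¹ :=
        Measurable.inv (Continuous.measurable (by fun_prop))
      exact (h2.mul h3).smul h1
    · refine Filter.Eventually.of_forall fun t _ w hw => ?_
      simp only [G']
      rw [norm_smul]
      have : ‖deriv (circleMap 0 1) t * ((circleMap 0 1 t - 0) ^ 2)⁻¹‖ = 1 := by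
        simp [deriv_circleMap]
      rw [this, one_mul]
      exact hfd _ (hin w hw _ (hcm t))
    · exact intervalIntegrable_const
    · refine Filter.Eventually.of_forall fun t _ w hw => ?_
      have h1 : HasFDerivAt (fun w => f (w + circleMap 0 1 t • v))
          (fderiv ℂ f (w + circleMap 0 1 t • v)) w := by
        have := (hinU _ (hin w hw _ (hcm t))).hasFDerivAt.comp w
          ((hasFDerivAt_id w).add_const (circleMap 0 1 t • v))
        rw [ContinuousLinearMap.comp_id] at this
        exact this
      have := (h1.const_smul (((circleMap 0 1 t - 0) ^ 2)⁻¹)).const_smul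
        (deriv (circleMap 0 1) t)
      simp only [G', mul_smul]
      exact this
  have hev : (fun w => fderiv ℂ f w v) =ᶠ[nhds w₀] fun w =>
      (2 * Real.pi * Complex.I : ℂ)⁻¹ • ∫ t in (0 : ℝ)..2 * Real.pi, G w t := by
    filter_upwards [Metric.ball_mem_nhds w₀ hδ] with w hw using hrep w hw
  refine DifferentiableAt.congr_of_eventuallyEq ?_ hev
  exact hmain.differentiableAt.const_smul (2 * Real.pi * Complex.I : ℂ)⁻¹

theorem holo_fderiv {E : Type*} [NormedAddCommGroup E] [NormedSpace ℂ E]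
    [FiniteDimensional ℂ E] {U : Set E} (hU : IsOpen U) {f : E → ℂ}
    (hf : DifferentiableOn ℂ f U) (v : E) :
    DifferentiableOn ℂ (fun w => fderiv ℂ f w v) U :=
  fun w hw => (holo_fderiv_aux hU hf w hw v).differentiableWithinAt

theorem holo_fderiv_clm {E : Type*} [NormedAddCommGroup E] [NormedSpace ℂ E]
    [FiniteDimensional ℂ E] {U : Set E} (hU : IsOpen U) {f : E → ℂ}
    (hf : DifferentiableOn ℂ f U) :
    DifferentiableOn ℂ (fderiv ℂ f) U := by
  let b := Module.finBasis ℂ E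
  have h : fderiv ℂ f = fun w => ∑ i, (fderiv ℂ f w (b i)) •
      LinearMap.toContinuousLinearMap (b.coord i) := by
    funext w
    ext x
    simp only [sum_apply, smul_apply,
      LinearMap.coe_toContinuousLinearMap', Module.Basis.coord_apply, smul_eq_mul]
    conv_lhs => rw [← b.sum_repr x]
    simp only [map_sum, map_smul, smul_eq_mul]
    exact Finset.sum_congr rfl fun i _ => mul_comm _ _
  rw [h]
  refine DifferentiableOn.fun_sum fun i _ => ?_
  exact (holo_fderiv hU hf (b i)).smul_const _

theorem holo_symm {E : Type*} [NormedAddCommGroup E] [NormedSpace ℂ E]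
    [FiniteDimensional ℂ E] {U : Set E} (hU : IsOpen U) {f : E → ℂ}
    (hf : DifferentiableOn ℂ f U) {w : E} (hw : w ∈ U) (a b : E) :
    fderiv ℂ (fun w => fderiv ℂ f w a) w b = fderiv ℂ (fun w => fderiv ℂ f w b) w a := by
  have hd := ((holo_fderiv_clm hU hf).differentiableAt (hU.mem_nhds hw)).hasFDerivAt
  have h1 : ∀ᶠ y in nhds w, HasFDerivAt f (fderiv ℂ f y) y := by
    filter_upwards [hU.mem_nhds hw] with y hy
    exact (hf.differentiableAt (hU.mem_nhds hy)).hasFDerivAt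
  have h2 := second_derivative_symmetric_of_eventually h1 hd a b
  have h3 : ∀ c, HasFDerivAt (fun w => fderiv ℂ f w c)
      ((fderiv ℂ (fderiv ℂ f) w).flip c) w := fun c => by
    have := hd.clm_apply (hasFDerivAt_const c w)
    simpa using this
  rw [(h3 a).fderiv, (h3 b).fderiv]
  simpa using h2.symm

/-- Coordinates of the vector `∂/∂x_i + Σ_k q_i^k ∂/∂u^k`. -/
def evec {n m : ℕ} (q : Fin m → Fin n → ℂ) (i : Fin n) : Fin n ⊕ Fin m → ℂ :=
  Sum.elim (Pi.single i 1) (fun k => q k i)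

/-- Principal part of the determining equations. -/
def Pfun {n m : ℕ} (q : Fin m → Fin n → ℂ) (i j : Fin n) (μ : Fin m)
    (H : Fin n ⊕ Fin m → Fin n ⊕ Fin m → Fin n ⊕ Fin m → ℂ) : ℂ :=
  ∑ B, ∑ C, (H (Sum.inr μ) B C - ∑ s, q μ s * H (Sum.inl s) B C) * (evec q i B * evec q j C)

theorem Pfun_bilin {n m : ℕ} (q : Fin m → Fin n → ℂ) (i j : Fin n)
    (K : Fin n ⊕ Fin m → Fin n ⊕ Fin m → ℂ) :
    ∑ B, ∑ C, K B C * (evec q i B * evec q j C) =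
      K (Sum.inl i) (Sum.inl j) + ∑ l, q l j * K (Sum.inl i) (Sum.inr l)
      + ∑ k, q k i * (K (Sum.inr k) (Sum.inl j) + ∑ l, q l j * K (Sum.inr k) (Sum.inr l)) := by
  have h1 : ∀ B, ∑ C, K B C * (evec q i B * evec q j C) =
      evec q i B * (K B (Sum.inl j) + ∑ l, q l j * K B (Sum.inr l)) := by
    intro B
    rw [Fintype.sum_sum_type, mul_add, Finset.mul_sum]
    congr 1
    · simp [evec, Pi.single_apply]; ring
    · refine Finset.sum_congr rfl fun l _ => ?_
      simp only [evec, Sum.elim_inr]; ring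
  simp only [h1]
  rw [Fintype.sum_sum_type]
  simp [evec, Pi.single_apply]

/-- jet with two (possibly coinciding) nonzero entries -/
def qtwo {n m : ℕ} (x y : ℂ) (k l : Fin m) (a b : Fin n) : Fin m → Fin n → ℂ :=
  fun κ α => (if κ = k then (if α = a then x else 0) else 0)
    + (if κ = l then (if α = b then y else 0) else 0)

theorem qtwo_sum {n m : ℕ} (x y : ℂ) (k l : Fin m) (a b i : Fin n) (f : Fin m → ℂ) :
    ∑ κ, qtwo x y k l a b κ i * f κ
      = (if i = a then x else 0) * f k + (if i = b then y else 0) * f l := by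
  simp [qtwo, add_mul, Finset.sum_add_distrib]

theorem qtwo_sum' {n m : ℕ} (x y : ℂ) (k l μ : Fin m) (a b : Fin n) (f : Fin n → ℂ) :
    ∑ s, qtwo x y k l a b μ s * f s
      = (if μ = k then x else 0) * f a + (if μ = l then y else 0) * f b := by
  simp only [qtwo, add_mul, Finset.sum_add_distrib]
  congr 1
  · split_ifs <;> simp
  · split_ifs <;> simp

theorem Pfun_qtwo {n m : ℕ} (x y : ℂ) (k l : Fin m) (a b : Fin n) (i j : Fin n) (μ : Fin m)
    (H : Fin n ⊕ Fin m → Fin n ⊕ Fin m → Fin n ⊕ Fin m → ℂ) :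
    ∃ K : Fin n ⊕ Fin m → Fin n ⊕ Fin m → ℂ,
      (∀ B C, K B C = H (Sum.inr μ) B C - ((if μ = k then x else 0) * H (Sum.inl a) B C
        + (if μ = l then y else 0) * H (Sum.inl b) B C)) ∧
      Pfun (qtwo x y k l a b) i j μ H =
      K (Sum.inl i) (Sum.inl j) + ((if j = a then x else 0) * K (Sum.inl i) (Sum.inr k)
        + (if j = b then y else 0) * K (Sum.inl i) (Sum.inr l))
      + ((if i = a then x else 0) * (K (Sum.inr k) (Sum.inl j) +
          ((if j = a then x else 0) * K (Sum.inr k) (Sum.inr k)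
        + (if j = b then y else 0) * K (Sum.inr k) (Sum.inr l)))
        + (if i = b then y else 0) * (K (Sum.inr l) (Sum.inl j) +
          ((if j = a then x else 0) * K (Sum.inr l) (Sum.inr k)
        + (if j = b then y else 0) * K (Sum.inr l) (Sum.inr l)))) := by
  refine ⟨_, fun B C => rfl, ?_⟩
  unfold Pfun
  rw [Pfun_bilin]
  simp only [qtwo_sum, qtwo_sum']

theorem poly3 {c0 c1 c2 c3 : ℂ} (h : ∀ x : ℂ, c0 + c1 * x + c2 * x ^ 2 + c3 * x ^ 3 = 0) :
    c0 = 0 ∧ c1 = 0 ∧ c2 = 0 ∧ c3 = 0 := by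
  have h0 := h 0
  have h1 := h 1
  have h2 := h (-1)
  have h3 := h 2
  refine ⟨by linear_combination h0, ?_, ?_, ?_⟩
  · linear_combination h1 - (1/3) * h2 - (1/6) * h3 - (1/2) * h0
  · linear_combination (1/2) * h1 + (1/2) * h2 - h0
  · linear_combination (-1/2) * h1 - (1/6) * h2 + (1/6) * h3 + (1/2) * h0

theorem Pfun_kernel {n m : ℕ} (H : Fin n ⊕ Fin m → Fin n ⊕ Fin m → Fin n ⊕ Fin m → ℂ)
    (hs : ∀ A B C, H A B C = H A C B)
    (hP : ∀ q i j μ, Pfun q i j μ H = 0) (i₀ : Fin n) (k₀ : Fin m) :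
    (∀ A B C, A ≠ B → A ≠ C → H A B C = 0) ∧ (∀ A B, A ≠ B → H A A B = H B B B / 2) := by
  open Sum in
  have S0 : ∀ i j μ, H (inr μ) (inl i) (inl j) = 0 := by
    intro i j μ
    have h := hP 0 i j μ
    unfold Pfun at h
    rw [Pfun_bilin] at h
    simpa using h
  have S1 : ∀ i k μ, μ ≠ k → H (inr μ) (inl i) (inr k) = 0 ∧ H (inr μ) (inr k) (inr k) = 0 := by
    intro i k μ hμ
    have h := poly3 (c0 := H (inr μ) (inl i) (inl i)) (c1 := 2 * H (inr μ) (inl i) (inr k))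
      (c2 := H (inr μ) (inr k) (inr k)) (c3 := 0) (by
        intro x
        obtain ⟨K, hK, h⟩ := Pfun_qtwo x 0 k k i i i i μ H
        rw [hP] at h
        simp [hK, hμ] at h
        linear_combination -h - x * hs (inr μ) (inr k) (inl i))
    exact ⟨by linear_combination (1/2) * h.2.1, h.2.2.1⟩
  have S1' : ∀ i k, H (inr k) (inl i) (inr k) = H (inl i) (inl i) (inl i) / 2 ∧
      H (inl i) (inl i) (inr k) = H (inr k) (inr k) (inr k) / 2 ∧
      H (inl i) (inr k) (inr k) = 0 := by
    intro i k
    have h := poly3 (c0 := H (inr k) (inl i) (inl i))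
      (c1 := 2 * H (inr k) (inl i) (inr k) - H (inl i) (inl i) (inl i))
      (c2 := H (inr k) (inr k) (inr k) - 2 * H (inl i) (inl i) (inr k))
      (c3 := - H (inl i) (inr k) (inr k)) (by
        intro x
        obtain ⟨K, hK, h⟩ := Pfun_qtwo x 0 k k i i i i k H
        rw [hP] at h
        simp [hK] at h
        linear_combination -h - x * hs (inr k) (inr k) (inl i)
          + x ^ 2 * hs (inl i) (inr k) (inl i))
    obtain ⟨-, h1, h2, h3⟩ := h
    exact ⟨by linear_combination (1/2) * h1, by linear_combination (-1/2) * h2,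
      by linear_combination -h3⟩
  have S2 : ∀ k l μ, μ ≠ k → μ ≠ l → H (inr μ) (inr k) (inr l) = 0 := by
    intro k l μ hk hl
    by_cases hkl : k = l
    · subst hkl
      exact (S1 i₀ k μ hk).2
    obtain ⟨K, hK, h⟩ := Pfun_qtwo 1 1 k l i₀ i₀ i₀ i₀ μ H
    rw [hP] at h
    simp [hK, hk, hl] at h
    have := S1 i₀ k μ hk
    have := S1 i₀ l μ hl
    have := S0 i₀ i₀ μ
    have := hs (inr μ) (inr k) (inr l)
    have := hs (inr μ) (inr k) (inl i₀)
    have := hs (inr μ) (inr l) (inl i₀)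
    grind
  have S2' : ∀ i k l, k ≠ l → H (inr k) (inr k) (inr l) = H (inr l) (inr l) (inr l) / 2 ∧
      H (inl i) (inr k) (inr l) = 0 := by
    intro i k l hkl
    obtain ⟨K, hK, h⟩ := Pfun_qtwo 1 1 k l i i i i k H
    obtain ⟨K', hK', h'⟩ := Pfun_qtwo (-1) 1 k l i i i i k H
    rw [hP] at h h'
    simp [hK, hK', hkl] at h h'
    have := S1 i l k hkl
    have := S1' i k
    have := S1' i l
    have := S0 i i k
    have := hs (inr k) (inr k) (inr l)
    have := hs (inr k) (inr k) (inl i)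
    have := hs (inr k) (inr l) (inl i)
    have := hs (inl i) (inr k) (inr l)
    have := hs (inl i) (inr k) (inl i)
    have := hs (inl i) (inr l) (inl i)
    grind
  have S2'' : ∀ i k l, H (inl i) (inr k) (inr l) = 0 := by
    intro i k l
    by_cases hkl : k = l
    · subst hkl
      exact (S1' i k).2.2
    · exact (S2' i k l hkl).2
  have S3 : ∀ i j s, s ≠ i → s ≠ j → H (inl s) (inl i) (inl j) = 0 := by
    intro i j s hi hj
    obtain ⟨K, hK, h⟩ := Pfun_qtwo 1 0 k₀ k₀ s s i j k₀ H
    rw [hP] at h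
    simp [hK, hi.symm, hj.symm, S0] at h
    exact h
  have S4 : ∀ i k s, s ≠ i → H (inl s) (inl i) (inr k) = 0 := by
    intro i k s hi
    obtain ⟨K, hK, h⟩ := Pfun_qtwo 1 1 k k i s i i k H
    rw [hP] at h
    simp [hK, hi.symm] at h
    have := S1' i k
    have := S0 i i k
    have := hs (inr k) (inr k) (inl i)
    have := hs (inl i) (inr k) (inl i)
    have := hs (inl s) (inr k) (inl i)
    have := S3 i i s hi hi
    have := S2'' s k k
    grind
  have S6 : ∀ i j, i ≠ j → H (inl i) (inl i) (inl j) = H (inl j) (inl j) (inl j) / 2 := by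
    intro i j hij
    have h := poly3 (c0 := H (inr k₀) (inl i) (inl j))
      (c1 := H (inr k₀) (inr k₀) (inl j) - H (inl i) (inl i) (inl j))
      (c2 := - H (inl i) (inr k₀) (inl j))
      (c3 := 0) (by
        intro x
        obtain ⟨K, hK, h⟩ := Pfun_qtwo x 0 k₀ k₀ i i i j k₀ H
        rw [hP] at h
        simp [hK, hij.symm] at h
        linear_combination -h)
    obtain ⟨-, h1, -, -⟩ := h
    linear_combination -h1 + (S1' j k₀).1 + hs (inr k₀) (inr k₀) (inl j)
  refine ⟨?_, ?_⟩
  · rintro (a | a) (b | b) (c | c) hb hc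
    · exact S3 _ _ _ (by simpa using hb) (by simpa using hc)
    · exact S4 _ _ _ (by simpa using hb)
    · rw [hs]; exact S4 _ _ _ (by simpa using hc)
    · exact S2'' _ _ _
    · exact S0 _ _ _
    · exact (S1 _ _ _ (by simpa using hc)).1
    · rw [hs]; exact (S1 _ _ _ (by simpa using hb)).1
    · exact S2 _ _ _ (by simpa using hb) (by simpa using hc)
  · rintro (a | a) (b | b) hb
    · exact S6 _ _ (by simpa using hb)
    · exact (S1' _ _).2.1
    · rw [hs]; exact (S1' _ _).1
    · exact (S2' i₀ _ _ (by simpa using hb)).1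

theorem Pfun_all {n m : ℕ} (H : Fin n ⊕ Fin m → Fin n ⊕ Fin m → Fin n ⊕ Fin m → ℂ)
    (Q : Set (Fin m → Fin n → ℂ)) (hQ : IsOpen Q) (hne : Q.Nonempty) (i j : Fin n) (μ : Fin m)
    (hP : ∀ q ∈ Q, Pfun q i j μ H = 0) (q : Fin m → Fin n → ℂ) : Pfun q i j μ H = 0 := by
  obtain ⟨q₀, hq₀⟩ := hne
  let f : ℂ → ℂ := fun t => Pfun (q₀ + t • (q - q₀)) i j μ H
  have hd : Differentiable ℂ f := by
    unfold f Pfun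
    simp only [Pfun_bilin]
    simp only [Pi.add_apply, Pi.smul_apply, Pi.sub_apply, smul_eq_mul]
    fun_prop
  have hev : f =ᶠ[nhds 0] 0 := by
    have : ∀ᶠ t : ℂ in nhds 0, q₀ + t • (q - q₀) ∈ Q := by
      have hc : Continuous fun t : ℂ => q₀ + t • (q - q₀) := by fun_prop
      exact hc.continuousAt.eventually (hQ.mem_nhds (by simpa using hq₀))
    filter_upwards [this] with t ht using hP _ ht
  have han : AnalyticOnNhd ℂ f Set.univ := fun z _ => hd.analyticAt z
  have := han.eqOn_zero_of_preconnected_of_eventuallyEq_zero isPreconnected_univ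
    (Set.mem_univ 0) hev (Set.mem_univ 1)
  simpa [f] using this

/-- `f` is, on `U`, a combination of the functions `Y i` with holomorphic coefficients. -/
def InSp {E ι : Type*} [NormedAddCommGroup E] [NormedSpace ℂ E] [Fintype ι]
    (U : Set E) (Y : ι → E → ℂ) (f : E → ℂ) : Prop :=
  ∃ a : ι → E → ℂ, (∀ i, DifferentiableOn ℂ (a i) U) ∧ ∀ w ∈ U, f w = ∑ i, a i w * Y i w

section InSp
variable {E ι κ : Type*} [NormedAddCommGroup E] [NormedSpace ℂ E] [Fintype ι] [Fintype κ]
  {U : Set E} {Y : ι → E → ℂ} {Z : κ → E → ℂ} {f g : E → ℂ}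

theorem InSp.congr (h : InSp U Y f) (hg : ∀ w ∈ U, g w = f w) : InSp U Y g := by
  obtain ⟨a, ha, h⟩ := h
  exact ⟨a, ha, fun w hw => by rw [hg w hw, h w hw]⟩

theorem InSp.zero : InSp U Y (fun _ => 0) :=
  ⟨fun _ _ => 0, fun _ => differentiableOn_const _, by simp⟩

theorem InSp.add (h : InSp U Y f) (h' : InSp U Y g) : InSp U Y (fun w => f w + g w) := by
  obtain ⟨a, ha, h⟩ := h
  obtain ⟨b, hb, h'⟩ := h'
  refine ⟨fun i w => a i w + b i w, fun i => (ha i).add (hb i), fun w hw => ?_⟩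
  dsimp only
  rw [h w hw, h' w hw, ← Finset.sum_add_distrib]
  exact Finset.sum_congr rfl fun i _ => by ring

theorem InSp.mul {c : E → ℂ} (hc : DifferentiableOn ℂ c U) (h : InSp U Y f) :
    InSp U Y (fun w => c w * f w) := by
  obtain ⟨a, ha, h⟩ := h
  refine ⟨fun i w => c w * a i w, fun i => hc.mul (ha i), fun w hw => ?_⟩
  dsimp only
  rw [h w hw, Finset.mul_sum]
  exact Finset.sum_congr rfl fun i _ => by ring

theorem InSp.smul (c : ℂ) (h : InSp U Y f) : InSp U Y (fun w => c * f w) :=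
  h.mul (differentiableOn_const c)

theorem InSp.sub (h : InSp U Y f) (h' : InSp U Y g) : InSp U Y (fun w => f w - g w) :=
  (h.add (h'.smul (-1))).congr fun w _ => by ring

theorem InSp.sum {α : Type*} (s : Finset α) {F : α → E → ℂ} (h : ∀ i ∈ s, InSp U Y (F i)) :
    InSp U Y (fun w => ∑ i ∈ s, F i w) := by
  classical
  induction s using Finset.induction_on with
  | empty => simpa using InSp.zero
  | insert a s ha ih =>
    simp only [Finset.sum_insert ha]
    exact (h a (Finset.mem_insert_self _ _)).add
      (ih fun i hi => h i (Finset.mem_insert_of_mem hi))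

theorem InSp.basis (i : ι) : InSp U Y (Y i) := by
  classical
  refine ⟨fun j _ => if j = i then 1 else 0, fun _ => differentiableOn_const _, fun w _ => ?_⟩
  simp

theorem InSp.mono (h : InSp U Y f) (hY : ∀ i, InSp U Z (Y i)) : InSp U Z f := by
  obtain ⟨a, ha, h⟩ := h
  exact (InSp.sum Finset.univ fun i _ => (hY i).mul (ha i)).congr h

theorem InSp.deriv [FiniteDimensional ℂ E] (hU : IsOpen U) (h : InSp U Y f)
    (hY : ∀ i, DifferentiableOn ℂ (Y i) U)
    (v : E) (h1 : ∀ i, InSp U Z (Y i)) (h2 : ∀ i, InSp U Z (fun w => fderiv ℂ (Y i) w v)) :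
    InSp U Z (fun w => fderiv ℂ f w v) := by
  obtain ⟨a, ha, h⟩ := h
  have key : InSp U Z (fun w => ∑ i, (fderiv ℂ (a i) w v * Y i w + a i w * fderiv ℂ (Y i) w v)) :=
    InSp.sum Finset.univ fun i _ =>
      ((h1 i).mul (holo_fderiv hU (ha i) v)).add ((h2 i).mul (ha i))
  refine key.congr fun w hw => ?_
  have hd : HasFDerivAt (fun w => ∑ i, a i w * Y i w)
      (∑ i, (a i w • fderiv ℂ (Y i) w + Y i w • fderiv ℂ (a i) w)) w := by
    refine HasFDerivAt.fun_sum fun i _ => ?_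
    exact ((ha i).differentiableAt (hU.mem_nhds hw)).hasFDerivAt.mul
      ((hY i).differentiableAt (hU.mem_nhds hw)).hasFDerivAt
  have hev : f =ᶠ[nhds w] fun w => ∑ i, a i w * Y i w := by
    filter_upwards [hU.mem_nhds hw] with z hz using h z hz
  have hd' := (hd.congr_of_eventuallyEq hev).fderiv
  simp only [hd', sum_apply]
  refine Finset.sum_congr rfl fun i _ => ?_
  simp
  ring

end InSp

/-- Uniqueness for closed linear first-order systems. -/
theorem closed_system_unique {E ι β : Type*} [NormedAddCommGroup E] [NormedSpace ℂ E]
    [FiniteDimensional ℂ E] [Fintype ι] [Fintype β] {U : Set E} (hU : IsOpen U)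
    (hc : IsPreconnected U) (Y : ι → E → ℂ) (hY : ∀ i, DifferentiableOn ℂ (Y i) U)
    (b : Module.Basis β ℂ E) (h : ∀ i B, InSp U Y (fun w => fderiv ℂ (Y i) w (b B)))
    (w₀ : E) (hw₀ : w₀ ∈ U) (h0 : ∀ i, Y i w₀ = 0) : ∀ w ∈ U, ∀ i, Y i w = 0 := by
  have hv : ∀ i v, InSp U Y (fun w => fderiv ℂ (Y i) w v) := by
    intro i v
    refine (InSp.sum Finset.univ fun B _ => (h i B).smul (b.repr v B)).congr fun w _ => ?_
    conv_lhs => rw [← b.sum_repr v]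
    simp only [map_sum, map_smul, smul_eq_mul]
  -- local uniqueness
  have hloc : ∀ w₁ ∈ U, (∀ i, Y i w₁ = 0) → ∀ᶠ w in nhds w₁, ∀ i, Y i w = 0 := by
    intro w₁ hw₁ hz
    obtain ⟨r, hr, hball⟩ := Metric.isOpen_iff.1 hU w₁ hw₁
    filter_upwards [Metric.ball_mem_nhds w₁ hr] with w hw
    choose a ha hfa using fun i => hv i (w - w₁)
    let p : ℝ → E := fun t => w₁ + (t : ℂ) • (w - w₁)
    have hpc : Continuous p := by fun_prop
    have hp : ∀ t ∈ Set.Icc (0 : ℝ) 1, p t ∈ U := by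
      intro t ht
      apply hball
      rw [mem_ball_iff_norm] at *
      have : p t - w₁ = (t : ℂ) • (w - w₁) := by simp [p]
      rw [this, norm_smul, Complex.norm_real, Real.norm_of_nonneg ht.1]
      nlinarith [norm_nonneg (w - w₁), ht.2]
    have hcont : ContinuousOn (fun t => ∑ i, ∑ j, ‖a i j (p t)‖) (Set.Icc (0 : ℝ) 1) := by
      refine continuousOn_finsetSum _ fun i _ => continuousOn_finsetSum _ fun j _ => ?_
      exact ((ha i j).continuousOn.comp hpc.continuousOn hp).norm
    obtain ⟨K, hK⟩ := (isCompact_Icc (a := (0 : ℝ)) (b := 1)).bddAbove_image hcont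
    have hderiv : ∀ t ∈ Set.Icc (0 : ℝ) 1, HasDerivAt (fun t i => Y i (p t))
        (fun i => fderiv ℂ (Y i) (p t) (w - w₁)) t := by
      intro t ht
      rw [hasDerivAt_pi]
      intro i
      have h1 : HasDerivAt (fun z : ℂ => w₁ + z • (w - w₁)) (w - w₁) (t : ℂ) := by
        simpa using ((hasDerivAt_id (t : ℂ)).smul_const (w - w₁)).const_add w₁
      have h2 := ((hY i).differentiableAt (hU.mem_nhds (hp t ht))).hasFDerivAt
      exact HasDerivAt.comp_ofReal (h2.comp_hasDerivAt (t : ℂ) h1)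
    have := eq_zero_of_abs_deriv_le_mul_abs_self_of_eq_zero_right (K := K)
      (f := fun t i => Y i (p t)) (f' := fun t i => fderiv ℂ (Y i) (p t) (w - w₁))
      (a := 0) (b := 1) (fun t ht => (hderiv t ht).continuousAt.continuousWithinAt)
      (fun t ht => (hderiv t (Set.Ico_subset_Icc_self ht)).hasDerivWithinAt)
      (by funext i; simpa [p] using hz i) (by
        intro t ht
        have ht' := Set.Ico_subset_Icc_self ht
        have hKt : ∑ i, ∑ j, ‖a i j (p t)‖ ≤ K := hK ⟨t, ht', rfl⟩
        have hK0 : 0 ≤ K := le_trans (by positivity) hKt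
        rw [pi_norm_le_iff_of_nonneg (by positivity)]
        intro i
        have hfa' : fderiv ℂ (Y i) (p t) (w - w₁) = _ := hfa i (p t) (hp t ht')
        rw [hfa']
        calc ‖∑ j, a i j (p t) * Y j (p t)‖ ≤ ∑ j, ‖a i j (p t) * Y j (p t)‖ := norm_sum_le _ _
          _ ≤ ∑ j, ‖a i j (p t)‖ * ‖fun i => Y i (p t)‖ := by
            refine Finset.sum_le_sum fun j _ => ?_
            rw [norm_mul]
            gcongr
            exact norm_le_pi_norm (fun i => Y i (p t)) j
          _ = (∑ j, ‖a i j (p t)‖) * ‖fun i => Y i (p t)‖ := by rw [Finset.sum_mul]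
          _ ≤ K * ‖fun i => Y i (p t)‖ := by
            gcongr
            refine le_trans ?_ hKt
            exact Finset.single_le_sum (f := fun i => ∑ j, ‖a i j (p t)‖)
              (fun i _ => by positivity) (Finset.mem_univ i))
      1 (by simp)
    intro i
    have := congrFun this i
    simpa [p] using this
  let S : Set E := {w | w ∈ U ∧ ∀ᶠ z in nhds w, ∀ i, Y i z = 0}
  have hSo : IsOpen S := hU.inter isOpen_setOfPred_eventually_nhds
  have hsub : U ⊆ S := by
    refine hc.subset_of_closure_inter_subset hSo ⟨w₀, hw₀, hw₀, hloc w₀ hw₀ h0⟩ ?_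
    rintro w ⟨hwc, hwU⟩
    refine ⟨hwU, hloc w hwU fun i => ?_⟩
    by_contra hne
    have hcw : ContinuousAt (Y i) w := ((hY i).differentiableAt (hU.mem_nhds hwU)).continuousAt
    have hnear := hcw.eventually_ne hne
    obtain ⟨z, hz1, hz2⟩ := mem_closure_iff_nhds.1 hwc _ hnear
    exact hz1 (hz2.2.self_of_nhds i)
  exact fun w hw i => (hsub hw).2.self_of_nhds i

/-- first-order jet functions -/
def Yzero {E I : Type*} [NormedAddCommGroup E] [NormedSpace ℂ E] (b : I → E) (X : I → E → ℂ) :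
    I ⊕ (I × I) → E → ℂ :=
  Sum.elim X (fun p w => fderiv ℂ (X p.1) w (b p.2))

/-- second derivatives -/
def Hfun {E I : Type*} [NormedAddCommGroup E] [NormedSpace ℂ E] (b : I → E) (X : I → E → ℂ)
    (A B C : I) (w : E) : ℂ :=
  fderiv ℂ (fun w => fderiv ℂ (X A) w (b B)) w (b C)

/-- the full jet determining a symmetry -/
def Yone {E I : Type*} [NormedAddCommGroup E] [NormedSpace ℂ E] (b : I → E) (X : I → E → ℂ) :
    (I ⊕ (I × I)) ⊕ I → E → ℂ :=
  Sum.elim (Yzero b X) (fun A w => Hfun b X A A A w)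

theorem jet_unique {E I : Type*} [NormedAddCommGroup E] [NormedSpace ℂ E]
    [FiniteDimensional ℂ E] [Fintype I] {U : Set E} (hU : IsOpen U)
    (hc : IsPreconnected U) (b : Module.Basis I ℂ E) (X : I → E → ℂ)
    (hX : ∀ A, DifferentiableOn ℂ (X A) U) (hI : ∀ A : I, ∃ C, C ≠ A)
    (ha : ∀ A B C, A ≠ B → A ≠ C → InSp U (Yzero b X) (fun w => Hfun b X A B C w))
    (hb : ∀ A B, A ≠ B → InSp U (Yzero b X) (fun w => Hfun b X A A B w - Hfun b X B B B w / 2))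
    (w₀ : E) (hw₀ : w₀ ∈ U) (h0 : ∀ i, Yone b X i w₀ = 0) : ∀ w ∈ U, ∀ A, X A w = 0 := by
  have hX1 : ∀ A B, DifferentiableOn ℂ (fun w => fderiv ℂ (X A) w (b B)) U :=
    fun A B => holo_fderiv hU (hX A) _
  have hH : ∀ A B C, DifferentiableOn ℂ (fun w => Hfun b X A B C w) U :=
    fun A B C => holo_fderiv hU (hX1 A B) _
  have hsym : ∀ A B C, ∀ w ∈ U, Hfun b X A B C w = Hfun b X A C B w :=
    fun A B C w hw => holo_symm hU (hX A) hw _ _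
  have hY0 : ∀ i, DifferentiableOn ℂ (Yzero b X i) U := by
    rintro (A | ⟨A, B⟩)
    · exact hX A
    · exact hX1 A B
  have hY1 : ∀ i, DifferentiableOn ℂ (Yone b X i) U := by
    rintro (i | A)
    · exact hY0 i
    · exact hH A A A
  have h01 : ∀ i, InSp U (Yone b X) (Yzero b X i) := fun i => InSp.basis (Y := Yone b X) (Sum.inl i)
  have hlam : ∀ A, InSp U (Yone b X) (fun w => Hfun b X A A A w) :=
    fun A => InSp.basis (Y := Yone b X) (Sum.inr A)
  have hHin' : ∀ A B, InSp U (Yone b X) (fun w => Hfun b X A A B w) := by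
    intro A B
    by_cases hAB : A = B
    · subst hAB; exact hlam A
    · refine (((hb A B hAB).mono h01).add ((hlam B).smul (1/2))).congr fun w _ => by ring
  have hHin : ∀ A B C, InSp U (Yone b X) (fun w => Hfun b X A B C w) := by
    intro A B C
    by_cases hAB : A = B
    · subst hAB; exact hHin' A C
    · by_cases hAC : A = C
      · subst hAC
        exact (hHin' A B).congr fun w hw => hsym _ _ _ w hw
      · exact (ha A B C hAB hAC).mono h01
  have hd0 : ∀ i C, InSp U (Yone b X) (fun w => fderiv ℂ (Yzero b X i) w (b C)) := by
    rintro (A | ⟨A, B⟩) C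
    · exact h01 (Sum.inr (A, C))
    · exact hHin A B C
  have hdM : ∀ f, InSp U (Yzero b X) f → ∀ C, InSp U (Yone b X) (fun w => fderiv ℂ f w (b C)) :=
    fun f hf C => hf.deriv hU hY0 (b C) h01 (fun i => hd0 i C)
  -- third derivatives
  have hT : ∀ A B C D, ∀ w ∈ U, fderiv ℂ (fun w => Hfun b X A B C w) w (b D) =
      fderiv ℂ (fun w => Hfun b X A B D w) w (b C) :=
    fun A B C D w hw => holo_symm hU (hX1 A B) hw _ _
  have hT' : ∀ A B C D, ∀ w ∈ U, fderiv ℂ (fun w => Hfun b X A B C w) w (b D) =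
      fderiv ℂ (fun w => Hfun b X A C B w) w (b D) := by
    intro A B C D w hw
    have : (fun w => Hfun b X A B C w) =ᶠ[nhds w] (fun w => Hfun b X A C B w) := by
      filter_upwards [hU.mem_nhds hw] with z hz using hsym A B C z hz
    rw [this.fderiv_eq]
  -- derivative of relation (b)
  have hdb : ∀ A B, A ≠ B → ∀ D, InSp U (Yone b X) (fun w =>
      fderiv ℂ (fun w => Hfun b X A A B w) w (b D)
        - fderiv ℂ (fun w => Hfun b X B B B w) w (b D) / 2) := by
    intro A B hAB D
    refine (hdM _ (hb A B hAB) D).congr fun w hw => ?_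
    have h1 := ((hH A A B).differentiableAt (hU.mem_nhds hw)).hasFDerivAt
    have h2 := ((hH B B B).differentiableAt (hU.mem_nhds hw)).hasFDerivAt
    have h3 := h1.sub (h2.mul_const (1/2 : ℂ))
    have h4 : HasFDerivAt (fun w => Hfun b X A A B w - Hfun b X B B B w / 2) _ w :=
      h3.congr_of_eventuallyEq (Filter.Eventually.of_forall fun z => by simp; ring)
    rw [h4.fderiv]
    simp
    ring
  have hdl : ∀ A D, InSp U (Yone b X) (fun w => fderiv ℂ (fun w => Hfun b X A A A w) w (b D)) := by
    intro A D
    by_cases hAD : A = D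
    · subst hAD
      obtain ⟨C, hC⟩ := hI A
      refine (((hdM _ (ha C A A hC hC) C).sub (hdb C A hC A)).smul 2).congr fun w hw => ?_
      have := hT C A C A w hw
      rw [hT' C A C A w hw] at this
      rw [this]
      ring
    · refine (((hdb A D hAD A).smul (4/3)).add ((hdb D A (Ne.symm hAD) D).smul (2/3))).congr
        fun w hw => ?_
      have e1 := hT A A A D w hw
      have e2 := hT D D D A w hw
      linear_combination (4/3) * e1 + (2/3) * e2
  have hclosed : ∀ i C, InSp U (Yone b X) (fun w => fderiv ℂ (Yone b X i) w (b C)) := by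
    rintro (i | A) C
    · exact hd0 i C
    · exact hdl A C
  intro w hw A
  exact closed_system_unique hU hc (Yone b X) hY1 b hclosed w₀ hw₀ h0 w hw (Sum.inl (Sum.inl A))

/-- The standard basis of the base space. -/
def bW (n m : ℕ) : Module.Basis (Fin n ⊕ Fin m) ℂ (Wsp n m) :=
  (Pi.basisFun ℂ (Fin n)).prod (Pi.basisFun ℂ (Fin m))

theorem bW_inl (n m : ℕ) (i : Fin n) :
    bW n m (Sum.inl i) = ((Pi.single i 1 : Fin n → ℂ), 0) := by
  apply Prod.ext <;> simp [bW]

theorem bW_inr (n m : ℕ) (k : Fin m) :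
    bW n m (Sum.inr k) = (0, (Pi.single k 1 : Fin m → ℂ)) := by
  apply Prod.ext <;> simp [bW]

/-- The linear part of the total derivative direction. -/
def evL (n m : ℕ) (i : Fin n) : Jsp n m →L[ℂ] Wsp n m :=
  LinearMap.toContinuousLinearMap
    { toFun := fun q => (0, fun k => q k i)
      map_add' := fun q q' => by
        apply Prod.ext
        · simp
        · funext k; simp
      map_smul' := fun c q => by
        apply Prod.ext
        · simp
        · funext k; simp }

theorem evL_apply {n m : ℕ} (i : Fin n) (q : Jsp n m) :
    evL n m i q = (0, fun k => q k i) := rfl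

theorem evL_sum {n m : ℕ} (i : Fin n) (q : Jsp n m) :
    evL n m i q = ∑ k, q k i • ((0, (Pi.single k 1 : Fin m → ℂ)) : Wsp n m) := by
  rw [evL_apply]
  apply Prod.ext
  · simp [Prod.fst_sum]
  · funext k
    simp [Prod.snd_sum, Finset.sum_apply, Pi.single_apply]

/-- The direction of the total derivative. -/
def ev {n m : ℕ} (q : Jsp n m) (i : Fin n) : Wsp n m :=
  ((Pi.single i 1 : Fin n → ℂ), 0) + evL n m i q

theorem Dtot_eq {n m : ℕ} (ψ : Wsp n m → ℂ) (i : Fin n) (p : Psp n m) :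
    Dtot ψ i p = fderiv ℂ ψ p.1 (ev p.2 i) := by
  simp only [Dtot, ev, evL_sum, map_add, map_sum, map_smul, smul_eq_mul]

theorem ev_eq_sum {n m : ℕ} (q : Jsp n m) (i : Fin n) :
    ev q i = ∑ B, evec q i B • bW n m B := by
  rw [Fintype.sum_sum_type]
  simp only [bW_inl, bW_inr, evec, Sum.elim_inl, Sum.elim_inr, ev, evL_sum]
  congr 1
  simp [Pi.single_apply, ite_smul]

theorem Zfield_eq {n m : ℕ} (F : Fin n → Fin n → Fin m → Psp n m → ℂ) (j : Fin n)
    (p : Psp n m) : Zfield F j p = (ev p.2 j, fun k l => F j l k p) := by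
  have h1 : ∀ k : Fin m, diru n m k = ((0, (Pi.single k 1 : Fin m → ℂ)), 0) := fun k => rfl
  apply Prod.ext
  · simp only [Zfield, Prod.fst_add, Prod.fst_sum, Prod.smul_fst, dirx, diru, dirq, ev, evL_sum]
    simp
  · simp only [Zfield, Prod.snd_add, Prod.snd_sum, Prod.smul_snd, dirx, diru, dirq]
    funext k l
    simp [Finset.sum_apply, Pi.single_apply]

theorem DtotF_eq {n m : ℕ} (F : Fin n → Fin n → Fin m → Psp n m → ℂ) (φ : Psp n m → ℂ)
    (j : Fin n) (p : Psp n m) : DtotF F φ j p = fderiv ℂ φ p (Zfield F j p) := by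
  simp only [DtotF, Zfield, map_add, map_sum, map_smul, smul_eq_mul]

theorem Dtot_hasFDerivAt {n m : ℕ} {U : Set (Wsp n m)} (hU : IsOpen U) {ψ : Wsp n m → ℂ}
    (hψ : DifferentiableOn ℂ ψ U) (i : Fin n) (p : Psp n m) (hp : p.1 ∈ U) :
    ∃ L : Psp n m →L[ℂ] ℂ, HasFDerivAt (fun p => Dtot ψ i p) L p ∧ ∀ v,
      L v = fderiv ℂ (fderiv ℂ ψ) p.1 v.1 (ev p.2 i) + fderiv ℂ ψ p.1 (evL n m i v.2) := by
  have h1 : HasFDerivAt (fun p : Psp n m => fderiv ℂ ψ p.1)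
      ((fderiv ℂ (fderiv ℂ ψ) p.1).comp (ContinuousLinearMap.fst ℂ (Wsp n m) (Jsp n m))) p :=
    ((holo_fderiv_clm hU hψ).differentiableAt (hU.mem_nhds hp)).hasFDerivAt.comp p hasFDerivAt_fst
  have h2 : HasFDerivAt (fun p : Psp n m => ev p.2 i)
      ((evL n m i).comp (ContinuousLinearMap.snd ℂ (Wsp n m) (Jsp n m))) p :=
    (((evL n m i).hasFDerivAt (x := p.2)).comp p hasFDerivAt_snd).const_add _
  have h3 := h1.clm_apply h2
  refine ⟨_, h3.congr_of_eventuallyEq (Filter.Eventually.of_forall fun p => Dtot_eq ψ i p), ?_⟩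
  intro v
  simp [add_comm]

theorem eta1_hasFDerivAt {n m : ℕ} {U : Set (Wsp n m)} (hU : IsOpen U)
    {θ : Fin n → Wsp n m → ℂ} {η : Fin m → Wsp n m → ℂ}
    (hθ : ∀ s, DifferentiableOn ℂ (θ s) U) (hη : ∀ k, DifferentiableOn ℂ (η k) U)
    (μ : Fin m) (i : Fin n) (p : Psp n m) (hp : p.1 ∈ U) :
    ∃ L : Psp n m →L[ℂ] ℂ, HasFDerivAt (eta1 θ η μ i) L p ∧ ∀ v,
      L v = (fderiv ℂ (fderiv ℂ (η μ)) p.1 v.1 (ev p.2 i) + fderiv ℂ (η μ) p.1 (evL n m i v.2))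
        - ∑ s, ((fderiv ℂ (fderiv ℂ (θ s)) p.1 v.1 (ev p.2 i)
            + fderiv ℂ (θ s) p.1 (evL n m i v.2)) * p.2 μ s + Dtot (θ s) i p * v.2 μ s) := by
  obtain ⟨L0, hL0, hL0v⟩ := Dtot_hasFDerivAt hU (hη μ) i p hp
  choose L hL hLv using fun s => Dtot_hasFDerivAt hU (hθ s) i p hp
  let c : Fin n → (Psp n m →L[ℂ] ℂ) := fun s =>
    ((ContinuousLinearMap.proj s).comp (ContinuousLinearMap.proj μ)).comp
      (ContinuousLinearMap.snd ℂ (Wsp n m) (Jsp n m))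
  have hc : ∀ s, HasFDerivAt (fun p : Psp n m => p.2 μ s) (c s) p := fun s => (c s).hasFDerivAt
  refine ⟨_, hL0.sub (HasFDerivAt.fun_sum (u := Finset.univ) fun s _ => (hL s).mul (hc s)), ?_⟩
  intro v
  simp only [sub_apply, sum_apply, add_apply, smul_apply, smul_eq_mul, hL0v, hLv]
  congr 1
  refine Finset.sum_congr rfl fun s _ => ?_
  have : c s v = v.2 μ s := rfl
  rw [this]
  ring

theorem eta2_formula {n m : ℕ} {U : Set (Wsp n m)} (hU : IsOpen U)
    (F : Fin n → Fin n → Fin m → Psp n m → ℂ)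
    {θ : Fin n → Wsp n m → ℂ} {η : Fin m → Wsp n m → ℂ}
    (hθ : ∀ s, DifferentiableOn ℂ (θ s) U) (hη : ∀ k, DifferentiableOn ℂ (η k) U)
    (μ : Fin m) (i j : Fin n) (p : Psp n m) (hp : p.1 ∈ U) :
    eta2 F θ η μ i j p =
      (fderiv ℂ (fderiv ℂ (η μ)) p.1 (ev p.2 j) (ev p.2 i)
        + ∑ k, F j i k p * fderiv ℂ (η μ) p.1 (bW n m (Sum.inr k)))
        - ∑ s, ((fderiv ℂ (fderiv ℂ (θ s)) p.1 (ev p.2 j) (ev p.2 i)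
            + ∑ k, F j i k p * fderiv ℂ (θ s) p.1 (bW n m (Sum.inr k))) * p.2 μ s
          + Dtot (θ s) i p * F j s μ p)
      - ∑ k, Dtot (θ k) j p * F i k μ p := by
  obtain ⟨L, hL, hLv⟩ := eta1_hasFDerivAt hU hθ hη μ i p hp
  simp only [eta2, DtotF_eq, hL.fderiv, hLv, Zfield_eq, evL_sum, map_sum, map_smul, smul_eq_mul,
    bW_inr]

/-- All components of the vector field. -/
def Xf {n m : ℕ} (X : (Fin n → Wsp n m → ℂ) × (Fin m → Wsp n m → ℂ)) :
    Fin n ⊕ Fin m → Wsp n m → ℂ := Sum.elim X.1 X.2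

theorem snd_deriv_eq {n m : ℕ} {U : Set (Wsp n m)} (hU : IsOpen U) {ψ : Wsp n m → ℂ}
    (hψ : DifferentiableOn ℂ ψ U) {w : Wsp n m} (hw : w ∈ U) (a c : Wsp n m) :
    fderiv ℂ (fun w => fderiv ℂ ψ w a) w c = fderiv ℂ (fderiv ℂ ψ) w c a := by
  have hd := ((holo_fderiv_clm hU hψ).differentiableAt (hU.mem_nhds hw)).hasFDerivAt
  have h3 : HasFDerivAt (fun w => fderiv ℂ ψ w a) ((fderiv ℂ (fderiv ℂ ψ) w).flip a) w := by
    have := hd.clm_apply (hasFDerivAt_const a w)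
    simpa using this
  rw [h3.fderiv]
  rfl

theorem Pfun_Hfun {n m : ℕ} {U : Set (Wsp n m)} (hU : IsOpen U)
    {X : (Fin n → Wsp n m → ℂ) × (Fin m → Wsp n m → ℂ)}
    (hθ : ∀ s, DifferentiableOn ℂ (X.1 s) U) (hη : ∀ k, DifferentiableOn ℂ (X.2 k) U)
    (μ : Fin m) (i j : Fin n) (q : Jsp n m) (w : Wsp n m) (hw : w ∈ U) :
    Pfun q i j μ (fun A B C => Hfun (bW n m) (Xf X) A B C w) =
      fderiv ℂ (fderiv ℂ (X.2 μ)) w (ev q j) (ev q i)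
      - ∑ s, q μ s * fderiv ℂ (fderiv ℂ (X.1 s)) w (ev q j) (ev q i) := by
  have hexp : ∀ T : Wsp n m →L[ℂ] Wsp n m →L[ℂ] ℂ, T (ev q j) (ev q i) =
      ∑ B, ∑ C, T (bW n m C) (bW n m B) * (evec q i B * evec q j C) := by
    intro T
    rw [ev_eq_sum q j, ev_eq_sum q i]
    simp only [map_sum, map_smul, sum_apply, smul_apply, smul_eq_mul, Finset.mul_sum]
    refine Finset.sum_congr rfl fun B _ => Finset.sum_congr rfl fun C _ => ?_
    ring
  have h1 : ∀ B C, Hfun (bW n m) (Xf X) (Sum.inr μ) B C w =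
      fderiv ℂ (fderiv ℂ (X.2 μ)) w (bW n m C) (bW n m B) :=
    fun B C => snd_deriv_eq hU (hη μ) hw _ _
  have h2 : ∀ s B C, Hfun (bW n m) (Xf X) (Sum.inl s) B C w =
      fderiv ℂ (fderiv ℂ (X.1 s)) w (bW n m C) (bW n m B) :=
    fun s B C => snd_deriv_eq hU (hθ s) hw _ _
  simp only [Pfun, h1, h2, hexp, sub_mul, Finset.sum_sub_distrib]
  congr 1
  simp only [Finset.sum_mul, Finset.mul_sum]
  conv_rhs => rw [Finset.sum_comm]
  refine Finset.sum_congr rfl fun B _ => ?_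
  conv_rhs => rw [Finset.sum_comm]
  refine Finset.sum_congr rfl fun C _ => Finset.sum_congr rfl fun s _ => ?_
  ring

section Sym
variable {n m : ℕ} {U : Set (Wsp n m)} {Q : Set (Jsp n m)}
  {F : Fin n → Fin n → Fin m → Psp n m → ℂ}

theorem slice_holo {G : Psp n m → ℂ} (hG : DifferentiableOn ℂ G (U ×ˢ Q)) {q : Jsp n m}
    (hq : q ∈ Q) : DifferentiableOn ℂ (fun w => G (w, q)) U := by
  refine DifferentiableOn.comp (f := fun w : Wsp n m => (w, q)) hG ?_ ?_
  · exact (differentiable_id.prodMk (differentiable_const q)).differentiableOn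
  · exact fun w hw => ⟨hw, hq⟩

theorem inSp_fderiv {X : (Fin n → Wsp n m → ℂ) × (Fin m → Wsp n m → ℂ)} (A : Fin n ⊕ Fin m)
    (v : Wsp n m) : InSp U (Yzero (bW n m) (Xf X)) (fun w => fderiv ℂ (Xf X A) w v) := by
  refine (InSp.sum Finset.univ fun B _ =>
    (InSp.basis (U := U) (Y := Yzero (bW n m) (Xf X)) (Sum.inr (A, B))).smul
      ((bW n m).repr v B)).congr fun w _ => ?_
  conv_lhs => rw [← (bW n m).sum_repr v]
  simp only [map_sum, map_smul, smul_eq_mul]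
  rfl

theorem inSp_Pfun (hU : IsOpen U) (hQ : IsOpen Q)
    (hF : ∀ i j k, DifferentiableOn ℂ (F i j k) (U ×ˢ Q))
    {X : (Fin n → Wsp n m → ℂ) × (Fin m → Wsp n m → ℂ)} (hX : X ∈ SymSet U Q F)
    (q : Jsp n m) (hq : q ∈ Q) (i j : Fin n) (μ : Fin m) :
    InSp U (Yzero (bW n m) (Xf X))
      (fun w => Pfun q i j μ (fun A B C => Hfun (bW n m) (Xf X) A B C w)) := by
  obtain ⟨hθ, hη, hs⟩ := hX
  have hUQ : IsOpen (U ×ˢ Q) := hU.prod hQ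
  have hθv : ∀ s v, InSp U (Yzero (bW n m) (Xf X)) (fun w => fderiv ℂ (X.1 s) w v) :=
    fun s v => inSp_fderiv (Sum.inl s) v
  have hηv : ∀ s v, InSp U (Yzero (bW n m) (Xf X)) (fun w => fderiv ℂ (X.2 s) w v) :=
    fun s v => inSp_fderiv (Sum.inr s) v
  have hθ0 : ∀ s, InSp U (Yzero (bW n m) (Xf X)) (fun w => X.1 s w) :=
    fun s => InSp.basis (Y := Yzero (bW n m) (Xf X)) (Sum.inl (Sum.inl s))
  have hη0 : ∀ s, InSp U (Yzero (bW n m) (Xf X)) (fun w => X.2 s w) :=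
    fun s => InSp.basis (Y := Yzero (bW n m) (Xf X)) (Sum.inl (Sum.inr s))
  have hDθ : ∀ s i, InSp U (Yzero (bW n m) (Xf X)) (fun w => Dtot (X.1 s) i (w, q)) :=
    fun s i => (hθv s (ev q i)).congr fun w _ => Dtot_eq _ _ _
  have hDη : ∀ s i, InSp U (Yzero (bW n m) (Xf X)) (fun w => Dtot (X.2 s) i (w, q)) :=
    fun s i => (hηv s (ev q i)).congr fun w _ => Dtot_eq _ _ _
  have hE1 : ∀ k l, InSp U (Yzero (bW n m) (Xf X)) (fun w => eta1 X.1 X.2 k l (w, q)) := by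
    intro k l
    refine ((hDη k l).sub (InSp.sum Finset.univ fun s _ =>
      (hDθ s l).smul (q k s))).congr fun w _ => ?_
    simp only [eta1]
    congr 1
    exact Finset.sum_congr rfl fun s _ => mul_comm _ _
  have hFq : ∀ i j k, DifferentiableOn ℂ (fun w => F i j k (w, q)) U :=
    fun i j k => slice_holo (hF i j k) hq
  have hdF : ∀ i j k v, DifferentiableOn ℂ (fun w => fderiv ℂ (F i j k) (w, q) v) U :=
    fun i j k v => slice_holo (holo_fderiv hUQ (hF i j k) v) hq
  have T1 := InSp.sum Finset.univ fun s _ => (hθ0 s).mul (hdF i j μ (dirx n m s))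
  have T2 := InSp.sum Finset.univ fun s _ => (hη0 s).mul (hdF i j μ (diru n m s))
  have T3 := InSp.sum Finset.univ fun k _ => InSp.sum Finset.univ fun l _ =>
    (hE1 k l).mul (hdF i j μ (dirq n m k l))
  have T4 := InSp.sum Finset.univ fun k _ => (hDθ k j).mul (hFq i k μ)
  have T5 := InSp.sum Finset.univ fun k _ => (hηv μ (bW n m (Sum.inr k))).mul (hFq j i k)
  have T6 := InSp.sum Finset.univ fun s _ => ((InSp.sum Finset.univ fun k _ =>
    (hθv s (bW n m (Sum.inr k))).mul (hFq j i k)).smul (q μ s)).add ((hDθ s i).mul (hFq j s μ))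
  refine (((((T1.add T2).add T3).add T4).sub T5).add T6).congr fun w hw => ?_
  rw [Pfun_Hfun hU hθ hη μ i j q w hw]
  have h1 := hs (w, q) ⟨hw, hq⟩ i j μ
  rw [eta2_formula hU F hθ hη μ i j (w, q) hw] at h1
  have h2 : ∀ a b c d : Fin n → ℂ, ∑ s, ((a s + b s) * c s + d s)
      = ∑ s, c s * a s + ∑ s, (c s * b s + d s) := by
    intro a b c d
    rw [← Finset.sum_add_distrib]
    exact Finset.sum_congr rfl fun s _ => by ring
  rw [h2] at h1
  simp only [mul_comm (fderiv ℂ (F i j μ) (w, q) _), mul_comm (F i _ μ (w, q)),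
    mul_comm (F j _ μ (w, q))]
  linear_combination h1

theorem inSp_rel (hU : IsOpen U) (hQ : IsOpen Q) (hne : Q.Nonempty) (i₀ : Fin n) (k₀ : Fin m)
    (hF : ∀ i j k, DifferentiableOn ℂ (F i j k) (U ×ˢ Q))
    {X : (Fin n → Wsp n m → ℂ) × (Fin m → Wsp n m → ℂ)} (hX : X ∈ SymSet U Q F) :
    (∀ A B C, A ≠ B → A ≠ C →
      InSp U (Yzero (bW n m) (Xf X)) (fun w => Hfun (bW n m) (Xf X) A B C w)) ∧
    (∀ A B, A ≠ B → InSp U (Yzero (bW n m) (Xf X))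
      (fun w => Hfun (bW n m) (Xf X) A A B w - Hfun (bW n m) (Xf X) B B B w / 2)) := by
  let V := Fin n ⊕ Fin m → Fin n ⊕ Fin m → Fin n ⊕ Fin m → ℂ
  let Hw : Wsp n m → V := fun w A B C => Hfun (bW n m) (Xf X) A B C w
  let Λ : Submodule ℂ (Module.Dual ℂ V) :=
    { carrier := {ℓ | InSp U (Yzero (bW n m) (Xf X)) (fun w => ℓ (Hw w))}
      add_mem' := fun ha hb => InSp.add ha hb
      zero_mem' := InSp.zero
      smul_mem' := fun c _ ha => InSp.smul c ha }
  have hΛ : ∀ ℓ : Module.Dual ℂ V, ℓ ∈ Λ ↔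
    InSp U (Yzero (bW n m) (Xf X)) (fun w => ℓ (Hw w)) := fun ℓ => Iff.rfl
  let co : Fin n ⊕ Fin m → Fin n ⊕ Fin m → Fin n ⊕ Fin m → Module.Dual ℂ V := fun A B C =>
    { toFun := fun H => H A B C, map_add' := fun _ _ => rfl, map_smul' := fun _ _ => rfl }
  have hco : ∀ A B C (H : V), co A B C H = H A B C := fun A B C H => rfl
  let PL : Jsp n m → Fin n → Fin n → Fin m → Module.Dual ℂ V := fun q i j μ =>
    ∑ B, ∑ C, (evec q i B * evec q j C) • (co (Sum.inr μ) B C - ∑ s, q μ s • co (Sum.inl s) B C)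
  have hPL : ∀ q i j μ (H : V), PL q i j μ H = Pfun q i j μ H := by
    intro q i j μ H
    simp only [PL, Pfun, LinearMap.sum_apply, LinearMap.smul_apply, LinearMap.sub_apply,
      smul_eq_mul, hco]
    exact Finset.sum_congr rfl fun B _ => Finset.sum_congr rfl fun C _ => mul_comm _ _
  have hXd : ∀ A, DifferentiableOn ℂ (Xf X A) U := by
    rintro (s | k)
    · exact hX.1 s
    · exact hX.2.1 k
  have key : ∀ ℓ : Module.Dual ℂ V, (∀ H : V,
      (∀ A B C, A ≠ B → A ≠ C → H A B C = 0) → (∀ A B, A ≠ B → H A A B = H B B B / 2) →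
        ℓ H = 0) → ℓ ∈ Λ := by
    intro ℓ hℓ
    rw [← Subspace.dualCoannihilator_dualAnnihilator_eq (W := Λ), Submodule.mem_dualAnnihilator]
    intro H hH
    rw [Submodule.mem_dualCoannihilator] at hH
    have hsym : ∀ A B C, H A B C = H A C B := by
      intro A B C
      have h1 : co A B C - co A C B ∈ Λ := by
        rw [hΛ]
        refine InSp.zero.congr fun w hw => ?_
        simp only [LinearMap.sub_apply, hco, Hw]
        exact sub_eq_zero.2 (holo_symm hU (hXd A) hw _ _)
      exact sub_eq_zero.1 (hH _ h1)
    have hPz : ∀ q i j μ, Pfun q i j μ H = 0 := by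
      intro q i j μ
      refine Pfun_all H Q hQ hne i j μ (fun q hq => ?_) q
      rw [← hPL]
      refine hH _ ((hΛ _).2 ?_)
      simp only [hPL]
      exact inSp_Pfun hU hQ hF hX q hq i j μ
    obtain ⟨h1, h2⟩ := Pfun_kernel H hsym hPz i₀ k₀
    exact hℓ H h1 h2
  refine ⟨fun A B C hAB hAC => ?_, fun A B hAB => ?_⟩
  · exact key (co A B C) fun H h1 _ => h1 A B C hAB hAC
  · refine InSp.congr (key (co A A B - (1 / 2 : ℂ) • co B B B) fun H _ h2 => ?_) fun w _ => ?_
    · simp only [LinearMap.sub_apply, LinearMap.smul_apply, hco, h2 A B hAB, smul_eq_mul]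
      ring
    · simp only [LinearMap.sub_apply, LinearMap.smul_apply, hco, smul_eq_mul, Hw]
      ring

theorem sym_zero : (0 : (Fin n → Wsp n m → ℂ) × (Fin m → Wsp n m → ℂ)) ∈ SymSet U Q F := by
  have h0 : ∀ (i : Fin n) (p : Psp n m), Dtot (0 : Wsp n m → ℂ) i p = 0 := by
    intro i p
    simp [Dtot]
  have h1 : ∀ (μ : Fin m) (i : Fin n),
      eta1 (0 : Fin n → Wsp n m → ℂ) (0 : Fin m → Wsp n m → ℂ) μ i = fun _ => 0 := by
    intro μ i
    funext p
    simp [eta1, h0]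
  refine ⟨fun j => differentiableOn_const _, fun j => differentiableOn_const _, ?_⟩
  intro p hp i j μ
  simp [eta2, h1, h0, DtotF_eq]

theorem sym_lin (hU : IsOpen U) (c : ℂ) {X Y : (Fin n → Wsp n m → ℂ) × (Fin m → Wsp n m → ℂ)}
    (hX : X ∈ SymSet U Q F) (hY : Y ∈ SymSet U Q F) : X + c • Y ∈ SymSet U Q F := by
  obtain ⟨hX1, hX2, hXs⟩ := hX
  obtain ⟨hY1, hY2, hYs⟩ := hY
  have hD : ∀ (f g : Wsp n m → ℂ), DifferentiableOn ℂ f U → DifferentiableOn ℂ g U →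
      ∀ i (p : Psp n m), p.1 ∈ U → Dtot (f + c • g) i p = Dtot f i p + c * Dtot g i p := by
    intro f g hf hg i p hp
    have h1 := (hf.differentiableAt (hU.mem_nhds hp)).hasFDerivAt
    have h2 := (hg.differentiableAt (hU.mem_nhds hp)).hasFDerivAt
    have h3 := (h1.add (h2.const_smul c)).fderiv
    simp only [Dtot_eq, h3]
    simp
  have hE : ∀ μ i (p : Psp n m), p.1 ∈ U → eta1 (X + c • Y).1 (X + c • Y).2 μ i p
      = eta1 X.1 X.2 μ i p + c * eta1 Y.1 Y.2 μ i p := by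
    intro μ i p hp
    have h1 : ∀ s, Dtot ((X + c • Y).1 s) i p = Dtot (X.1 s) i p + c * Dtot (Y.1 s) i p :=
      fun s => hD _ _ (hX1 s) (hY1 s) i p hp
    have h2 : Dtot ((X + c • Y).2 μ) i p = Dtot (X.2 μ) i p + c * Dtot (Y.2 μ) i p :=
      hD _ _ (hX2 μ) (hY2 μ) i p hp
    simp only [eta1, h1, h2, mul_sub, Finset.mul_sum, add_mul, Finset.sum_add_distrib, mul_assoc]
    ring
  refine ⟨fun j => (hX1 j).add ((hY1 j).const_smul c), fun j => (hX2 j).add ((hY2 j).const_smul c),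
    ?_⟩
  intro p hp i j μ
  have hXp := hXs p hp i j μ
  have hYp := hYs p hp i j μ
  have hF : DtotF F (eta1 (X + c • Y).1 (X + c • Y).2 μ i) j p
      = DtotF F (eta1 X.1 X.2 μ i) j p + c * DtotF F (eta1 Y.1 Y.2 μ i) j p := by
    obtain ⟨L, hL, -⟩ := eta1_hasFDerivAt hU hX1 hX2 μ i p hp.1
    obtain ⟨L', hL', -⟩ := eta1_hasFDerivAt hU hY1 hY2 μ i p hp.1
    have hev : eta1 (X + c • Y).1 (X + c • Y).2 μ i =ᶠ[nhds p]
        eta1 X.1 X.2 μ i + c • eta1 Y.1 Y.2 μ i := by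
      filter_upwards [(hU.preimage continuous_fst).mem_nhds hp.1] with z hz
      exact hE μ i z hz
    have h3 := ((hL.add (hL'.const_smul c)).congr_of_eventuallyEq hev).fderiv
    simp only [DtotF_eq, h3, hL.fderiv, hL'.fderiv]
    simp
  have h1 : ∀ s, Dtot ((X + c • Y).1 s) j p = Dtot (X.1 s) j p + c * Dtot (Y.1 s) j p :=
    fun s => hD _ _ (hX1 s) (hY1 s) j p hp.1
  have h2 : ∀ s, (X + c • Y).1 s p.1 = X.1 s p.1 + c * Y.1 s p.1 := fun s => rfl
  have h3 : ∀ s, (X + c • Y).2 s p.1 = X.2 s p.1 + c * Y.2 s p.1 := fun s => rfl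
  simp only [eta2] at hXp hYp ⊢
  simp only [hF, h1, h2, h3, hE _ _ p hp.1, add_mul, Finset.sum_add_distrib, mul_assoc,
    ← Finset.mul_sum]
  linear_combination hXp + c * hYp

theorem fderiv_comb {E ι : Type*} [NormedAddCommGroup E] [NormedSpace ℂ E] [Fintype ι]
    {V : Set E} (hV : IsOpen V) (c : ι → ℂ) (f : ι → E → ℂ)
    (hf : ∀ i, DifferentiableOn ℂ (f i) V) (g : E → ℂ) (hg : ∀ w ∈ V, g w = ∑ i, c i * f i w)
    (w : E) (hw : w ∈ V) (v : E) : fderiv ℂ g w v = ∑ i, c i * fderiv ℂ (f i) w v := by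
  have hd : HasFDerivAt (fun w => ∑ i, c i * f i w) (∑ i, c i • fderiv ℂ (f i) w) w :=
    HasFDerivAt.fun_sum fun i _ =>
      ((hf i).differentiableAt (hV.mem_nhds hw)).hasFDerivAt.const_mul (c i)
  have hev : g =ᶠ[nhds w] fun w => ∑ i, c i * f i w := by
    filter_upwards [hV.mem_nhds hw] with z hz using hg z hz
  rw [(hd.congr_of_eventuallyEq hev).fderiv]
  simp

theorem Yone_comb {ι : Type*} [Fintype ι] (hU : IsOpen U) (c : ι → ℂ)
    (Xs : ι → (Fin n → Wsp n m → ℂ) × (Fin m → Wsp n m → ℂ))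
    (hXs : ∀ i, Xs i ∈ SymSet U Q F) (w : Wsp n m) (hw : w ∈ U) (a) :
    Yone (bW n m) (Xf (∑ i, c i • Xs i)) a w = ∑ i, c i * Yone (bW n m) (Xf (Xs i)) a w := by
  have hXd : ∀ i A, DifferentiableOn ℂ (Xf (Xs i) A) U := by
    rintro i (s | k)
    · exact (hXs i).1 s
    · exact (hXs i).2.1 k
  have h0 : ∀ A w, Xf (∑ i, c i • Xs i) A w = ∑ i, c i * Xf (Xs i) A w := by
    rintro (s | k) w
    · simp [Xf, Prod.fst_sum, Finset.sum_apply]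
    · simp [Xf, Prod.snd_sum, Finset.sum_apply]
  have h1 : ∀ A v, ∀ w ∈ U, fderiv ℂ (Xf (∑ i, c i • Xs i) A) w v
      = ∑ i, c i * fderiv ℂ (Xf (Xs i) A) w v := fun A v w hw =>
    fderiv_comb hU c (fun i => Xf (Xs i) A) (fun i => hXd i A) _ (fun w _ => h0 A w) w hw v
  rcases a with (A | ⟨A, B⟩) | A
  · exact h0 A w
  · exact h1 A _ w hw
  · exact fderiv_comb hU c (fun i w => fderiv ℂ (Xf (Xs i) A) w (bW n m A))
      (fun i => holo_fderiv hU (hXd i A) _) _ (fun w hw => h1 A _ w hw) w hw _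

end Sym

/-- Let the holomorphic completely overdetermined second order system
`(S_F)` be involutive.  Then the set of infinitesimal symmetries `(θ, η)` of `(S_F)`
is a complex vector space (it contains `0` and is closed under addition and scalar
multiplication) of dimension at most `(n+m+2)(n+m)`: any `(n+m+2)(n+m) + 1`
infinitesimal symmetries are linearly dependent over `ℂ` as functions on `U`. -/
theorem statement1 {n m : ℕ}
    (U : Set (Wsp (n + 1) (m + 1))) (Q : Set (Jsp (n + 1) (m + 1)))
    (hUo : IsOpen U) (hUc : IsConnected U)
    (hQo : IsOpen Q) (hQc : IsConnected Q)
    (F : Fin (n + 1) → Fin (n + 1) → Fin (m + 1) → Psp (n + 1) (m + 1) → ℂ)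
    (hF : ∀ i j k, DifferentiableOn ℂ (F i j k) (U ×ˢ Q))
    (hFsym : ∀ i j k, F i j k = F j i k)
    (hinv : IsInvolutive U Q F) :
    ((0 : (Fin (n + 1) → Wsp (n + 1) (m + 1) → ℂ) × (Fin (m + 1) → Wsp (n + 1) (m + 1) → ℂ))
        ∈ SymSet U Q F)
    ∧ (∀ X ∈ SymSet U Q F, ∀ Y ∈ SymSet U Q F, X + Y ∈ SymSet U Q F)
    ∧ (∀ c : ℂ, ∀ X ∈ SymSet U Q F, c • X ∈ SymSet U Q F)
    ∧ (∀ Xs : Fin ((n + 1 + (m + 1) + 2) * (n + 1 + (m + 1)) + 1) →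
          (Fin (n + 1) → Wsp (n + 1) (m + 1) → ℂ) × (Fin (m + 1) → Wsp (n + 1) (m + 1) → ℂ),
        (∀ i, Xs i ∈ SymSet U Q F) →
        ∃ c : Fin ((n + 1 + (m + 1) + 2) * (n + 1 + (m + 1)) + 1) → ℂ, c ≠ 0 ∧
          ∀ w ∈ U, (∀ j, ∑ i, c i * (Xs i).1 j w = 0) ∧ (∀ μ, ∑ i, c i * (Xs i).2 μ w = 0)) := by
  refine ⟨sym_zero, fun X hX Y hY => ?_, fun c X hX => ?_, fun Xs hXs => ?_⟩
  · simpa using sym_lin hUo 1 hX hY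
  · simpa using sym_lin hUo c sym_zero hX
  · obtain ⟨w₀, hw₀⟩ := hUc.nonempty
    let ι := Fin ((n + 1 + (m + 1) + 2) * (n + 1 + (m + 1)) + 1)
    let I := Fin (n + 1) ⊕ Fin (m + 1)
    let J : (ι → ℂ) →ₗ[ℂ] ((I ⊕ (I × I)) ⊕ I → ℂ) :=
      { toFun := fun c a => ∑ i, c i * Yone (bW (n + 1) (m + 1)) (Xf (Xs i)) a w₀
        map_add' := fun c d => by
          funext a
          simp [add_mul, Finset.sum_add_distrib]
        map_smul' := fun r c => by
          funext a
          simp [mul_assoc, Finset.mul_sum] }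
    have hker : LinearMap.ker J ≠ ⊥ := by
      apply LinearMap.ker_ne_bot_of_finrank_lt
      rw [Module.finrank_fintype_fun_eq_card, Module.finrank_fintype_fun_eq_card]
      simp only [ι, I, Fintype.card_sum, Fintype.card_prod, Fintype.card_fin]
      refine Nat.lt_succ_of_le (le_of_eq ?_)
      ring
    obtain ⟨c, hc, hc0⟩ := (Submodule.ne_bot_iff _).1 hker
    refine ⟨c, hc0, ?_⟩
    have hmem : ∑ i, c i • Xs i ∈ SymSet U Q F := by
      have : ∀ s : Finset ι, ∑ i ∈ s, c i • Xs i ∈ SymSet U Q F := by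
        intro s
        induction s using Finset.induction_on with
        | empty => simpa using sym_zero
        | insert a s ha ih =>
          rw [Finset.sum_insert ha, add_comm (c a • Xs a)]
          exact sym_lin hUo (c a) ih (hXs a)
      exact this Finset.univ
    obtain ⟨ha, hb⟩ := inSp_rel hUo hQo hQc.nonempty 0 0 hF hmem
    have hz := jet_unique hUo hUc.isPreconnected (bW (n + 1) (m + 1)) (Xf (∑ i, c i • Xs i))
      (by
        rintro (s | k)
        · exact hmem.1 s
        · exact hmem.2.1 k)
      (by
        rintro (s | k)
        · exact ⟨Sum.inr 0, by simp⟩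
        · exact ⟨Sum.inl 0, by simp⟩)
      ha hb w₀ hw₀ (by
        intro a
        rw [Yone_comb hUo c Xs hXs w₀ hw₀ a]
        exact congrFun hc a)
    intro w hw
    refine ⟨fun j => ?_, fun μ => ?_⟩
    · have := hz w hw (Sum.inl j)
      simpa [Xf, Prod.fst_sum, Finset.sum_apply] using this
    · have := hz w hw (Sum.inr μ)
      simpa [Xf, Prod.snd_sum, Finset.sum_apply] using this
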